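/- Finite reciprocity identity: for all n ≥ 1 and all x, y, q (complex), ∑_{j=0}^{n} [n choose j]_q f_j^{(2)}(x,y|q) d_{n-j}^{(2)}(x,y|q) = 0, where f_j^{(2)}(x,y|q) = ∑_{i=0}^{⌊j/2⌋} ((q;q)_j/((q;q)_i (q;q)_{j-2i})) h_{j-2i}(x|q) h_{j-2i}(y|q) and d_n^{(2)}(x,y|q) = (-1)^n ∑_{i=0}^{⌊n/2⌋} (-1)^i q^{-C(n-2i,2) - i + C(i,2)} ((q;q)_n/((q;q)_i (q;q)_{n-2i})) b_{n-2i}(x|q) b_{n-2i}(y|q). -/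

import Mathlib

/-- The Gaussian (q-)binomial coefficient, defined via the q-Pascal rule. -/
def gaussBinom (q : ℂ) : ℕ → ℕ → ℂ
  | _, 0 => 1
  | 0, _ + 1 => 0
  | n + 1, k + 1 => gaussBinom q n k + q ^ (k + 1) * gaussBinom q n (k + 1)

/-- The finite q-Pochhammer symbol `(q;q)_n`. -/
noncomputable def qPoch (q : ℂ) (n : ℕ) : ℂ := ∏ j ∈ Finset.range n, (1 - q ^ (j + 1))

/-- The continuous q-Hermite polynomials. -/
def qHermite (q x : ℂ) : ℕ → ℂ
  | 0 => 1
  | 1 => 2 * x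
  | n + 2 => 2 * x * qHermite q x (n + 1) - (1 - q ^ (n + 1)) * qHermite q x n

/-- The `q⁻¹`-Hermite polynomials. -/
def qInvHermite (q x : ℂ) : ℕ → ℂ
  | 0 => 1
  | 1 => -2 * x
  | n + 2 => -2 * q ^ (n + 1) * x * qInvHermite q x (n + 1)
      + q ^ n * (1 - q ^ (n + 1)) * qInvHermite q x n

/-- `f_j^{(2)}(x,y|q) = ∑_i ((q;q)_j/((q;q)_i (q;q)_{j-2i})) h_{j-2i}(x|q) h_{j-2i}(y|q)`. -/
noncomputable def f2 (q x y : ℂ) (j : ℕ) : ℂ :=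
  ∑ i ∈ Finset.range (j / 2 + 1),
    qPoch q j / (qPoch q i * qPoch q (j - 2 * i)) *
      qHermite q x (j - 2 * i) * qHermite q y (j - 2 * i)

/-- `d_n^{(2)}(x,y|q)`; note the (possibly negative) integer power of `q`. -/
noncomputable def d2 (q x y : ℂ) (n : ℕ) : ℂ :=
  (-1) ^ n * ∑ i ∈ Finset.range (n / 2 + 1),
    (-1) ^ i * q ^ (-(((n - 2 * i).choose 2 : ℤ)) - (i : ℤ) + ((i.choose 2 : ℤ))) *
      (qPoch q n / (qPoch q i * qPoch q (n - 2 * i))) *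
      qInvHermite q x (n - 2 * i) * qInvHermite q y (n - 2 * i)

lemma qPoch_succ (q : ℂ) (n : ℕ) : qPoch q (n + 1) = qPoch q n * (1 - q ^ (n + 1)) :=
  Finset.prod_range_succ _ _

@[simp] lemma qPoch_zero (q : ℂ) : qPoch q 0 = 1 := rfl

lemma qPoch_ne_zero_of_le {q : ℂ} {m n : ℕ} (h : qPoch q n ≠ 0) (hmn : m ≤ n) :
    qPoch q m ≠ 0 := by
  induction n, hmn using Nat.le_induction with
  | base => exact h
  | succ n _ ih => exact ih (left_ne_zero_of_mul (qPoch_succ q n ▸ h))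

lemma gaussBinom_eq_zero_of_lt (q : ℂ) {n k : ℕ} (h : n < k) : gaussBinom q n k = 0 := by
  induction n generalizing k with
  | zero =>
    obtain ⟨k, rfl⟩ := Nat.exists_eq_succ_of_ne_zero h.ne'
    simp [gaussBinom]
  | succ n ih =>
    obtain ⟨k, rfl⟩ := Nat.exists_eq_succ_of_ne_zero (Nat.ne_zero_of_lt h)
    simp [gaussBinom, ih (show n < k by omega), ih (show n < k + 1 by omega)]

lemma gaussBinom_self (q : ℂ) (n : ℕ) : gaussBinom q n n = 1 := by
  induction n with
  | zero => simp [gaussBinom]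
  | succ n ih => simp [gaussBinom, ih, gaussBinom_eq_zero_of_lt q (Nat.lt_succ_self n)]

lemma gaussBinom_zero_right (q : ℂ) (n : ℕ) : gaussBinom q n 0 = 1 := by
  cases n <;> simp [gaussBinom]

lemma gaussBinom_add_mul_qPoch (q : ℂ) (a b : ℕ) :
    gaussBinom q (a + b) a * qPoch q a * qPoch q b = qPoch q (a + b) := by
  induction a generalizing b with
  | zero => simp [gaussBinom_zero_right]
  | succ a iha =>
    induction b with
    | zero => simp [gaussBinom_self]
    | succ b ihb =>
      have h1 := iha (b + 1)
      have e : a + 1 + b = a + b + 1 := by ring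
      rw [e] at ihb
      rw [← add_assoc] at h1
      rw [show a + 1 + (b + 1) = (a + b + 1) + 1 by ring, gaussBinom, qPoch_succ q (a + b + 1)]
      have h2 := qPoch_succ q a
      have h3 := qPoch_succ q b
      rw [h3] at h1 ⊢
      rw [h2] at ihb ⊢
      linear_combination (1 - q ^ (a + 1)) * h1 + q ^ (a + 1) * (1 - q ^ (b + 1)) * ihb

lemma qPoch_eq_qPoch_inv {q : ℂ} (hq : q ≠ 0) (n : ℕ) :
    qPoch q n = (-1) ^ n * q ^ n.choose 2 * q ^ n * qPoch q⁻¹ n := by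
  induction n with
  | zero => simp
  | succ n ih =>
    rw [qPoch_succ, qPoch_succ, ih, Nat.choose_succ_succ' n 1, Nat.choose_one_right]
    have : q ^ n ≠ 0 := pow_ne_zero _ hq
    simp only [pow_add, pow_one, inv_pow]
    field_simp
    ring

lemma qInvHermite_eq_qHermite_inv {q : ℂ} (hq : q ≠ 0) (x : ℂ) (n : ℕ) :
    qInvHermite q x n = (-1) ^ n * q ^ n.choose 2 * qHermite q⁻¹ x n := by
  induction n using Nat.twoStepInduction with
  | zero => simp [qInvHermite, qHermite]
  | one => simp [qInvHermite, qHermite]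
  | more n ih0 ih1 =>
    rw [qInvHermite, qHermite, ih0, ih1]
    have : q ^ n ≠ 0 := pow_ne_zero _ hq
    rw [Nat.choose_succ_succ' (n + 1) 1, Nat.choose_succ_succ' n 1, Nat.choose_one_right,
      Nat.choose_one_right]
    simp only [pow_add, pow_one, inv_pow]
    field_simp
    ring

open PowerSeries

/-- The series `∑ t ^ (2 i) / (q;q)_i`. -/
noncomputable def qExpSq (q : ℂ) : ℂ⟦X⟧ :=
  PowerSeries.mk fun m => if Even m then (qPoch q (m / 2))⁻¹ else 0

/-- The `q`-Mehler series `∑ h_m(x|q) h_m(y|q) t ^ m / (q;q)_m`. -/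
noncomputable def qMehler (q x y : ℂ) : ℂ⟦X⟧ :=
  PowerSeries.mk fun m => qHermite q x m * qHermite q y m * (qPoch q m)⁻¹

/-- The polynomial `∏ (1 - t e ^ (± i θ ± i φ))` for `x = cos θ`, `y = cos φ`. -/
noncomputable def mehlerDenom (x y : ℂ) : ℂ⟦X⟧ :=
  1 - C (4 * x * y) * X ^ 1 + C (4 * x ^ 2 + 4 * y ^ 2 - 2) * X ^ 2 - C (4 * x * y) * X ^ 3 + X ^ 4

lemma coeff_qExpSq_mul (q : ℂ) (φ : ℂ⟦X⟧) (n : ℕ) :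
    coeff n (qExpSq q * φ) =
      ∑ i ∈ Finset.range (n / 2 + 1), (qPoch q i)⁻¹ * coeff (n - 2 * i) φ := by
  rw [coeff_mul, Finset.Nat.sum_antidiagonal_eq_sum_range_succ_mk]
  symm
  refine Finset.sum_of_injOn (fun i => 2 * i) (fun a _ b _ h => by simpa using h) ?_ ?_ ?_
  · intro i hi
    simp only [Finset.coe_range, Set.mem_Iio] at hi ⊢
    omega
  · intro k hk hk'
    have : ¬ Even k := by
      rintro ⟨i, rfl⟩
      refine hk' ⟨i, ?_, by simp only; ring⟩
      simp only [Finset.coe_range, Set.mem_Iio, Finset.mem_range] at hk ⊢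
      omega
    simp [qExpSq, this]
  · intro i _
    simp [qExpSq]

lemma X_pow_dvd_qExpSq {q : ℂ} {n : ℕ} (h : qPoch q n ≠ 0) :
    (X : ℂ⟦X⟧) ^ (n + 1) ∣
      (1 - C (1 + q) * X ^ 2 + C q * X ^ 4) * qExpSq q - rescale q (qExpSq q) := by
  rw [X_pow_dvd_iff]
  intro m hm
  have key : ∀ m, m ≤ n → qPoch q m ≠ 0 := fun m hm => qPoch_ne_zero_of_le h hm
  simp only [sub_mul, add_mul, one_mul, mul_assoc, map_sub, map_add, coeff_C_mul,
    coeff_X_pow_mul', coeff_rescale]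
  rcases Nat.even_or_odd' m with ⟨i, rfl | rfl⟩
  · match i with
    | 0 => simp [qExpSq]
    | 1 =>
      have h1 := key 1 (by omega)
      simp [qExpSq, qPoch_succ] at h1 ⊢
      field_simp
      ring
    | i + 2 =>
      have h1 := key (i + 2) (by omega)
      rw [if_pos (by omega), if_pos (by omega), show 2 * (i + 2) - 2 = 2 * (i + 1) by omega,
        show 2 * (i + 2) - 4 = 2 * i by omega]
      simp only [qExpSq, coeff_mk, even_two_mul, if_true, Nat.mul_div_cancel_left _ two_pos]
      rw [qPoch_succ, qPoch_succ] at h1 ⊢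
      have h2 := right_ne_zero_of_mul h1
      have h3 := left_ne_zero_of_mul (left_ne_zero_of_mul h1)
      have h4 := right_ne_zero_of_mul (left_ne_zero_of_mul h1)
      field_simp
      ring
  · have h1 : ¬ Even (2 * i + 1) := by simp
    have h2 : 2 ≤ 2 * i + 1 → ¬ Even (2 * i + 1 - 2) := by
      intro _; rw [Nat.even_iff]; omega
    have h3 : 4 ≤ 2 * i + 1 → ¬ Even (2 * i + 1 - 4) := by
      intro _; rw [Nat.even_iff]; omega
    simp only [qExpSq, coeff_mk, if_neg h1]
    split_ifs <;> first | (exfalso; tauto) | simp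

lemma X_pow_dvd_qMehler {q : ℂ} (x y : ℂ) {n : ℕ} (h : qPoch q n ≠ 0) :
    (X : ℂ⟦X⟧) ^ (n + 1) ∣ mehlerDenom x y * qMehler q x y -
      (1 - C (1 + q) * X ^ 2 + C q * X ^ 4) * rescale q (qMehler q x y) := by
  rw [X_pow_dvd_iff]
  intro m hm
  have key : qPoch q m ≠ 0 := qPoch_ne_zero_of_le h (by omega)
  simp only [mehlerDenom, sub_mul, add_mul, one_mul, mul_assoc, map_sub, map_add, coeff_C_mul,
    coeff_X_pow_mul', coeff_rescale]
  match m with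
  | 0 => simp [qMehler]
  | 1 =>
    simp [qMehler, qHermite, qPoch_succ] at key ⊢
    field_simp
    ring
  | 2 =>
    simp [qMehler, qHermite, qPoch_succ] at key ⊢
    obtain ⟨k1, k2⟩ := key
    field_simp
    ring
  | 3 =>
    simp [qMehler, qHermite, qPoch_succ] at key ⊢
    obtain ⟨⟨k1, k2⟩, k3⟩ := key
    field_simp
    ring
  | m + 4 =>
    simp [qMehler, qHermite, qPoch_succ] at key ⊢
    obtain ⟨⟨⟨⟨k0, k1⟩, k2⟩, k3⟩, k4⟩ := key
    field_simp
    ring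

lemma X_pow_dvd_mehlerDenom_mul {q : ℂ} (x y : ℂ) {n : ℕ} (h : qPoch q n ≠ 0) :
    (X : ℂ⟦X⟧) ^ (n + 1) ∣ mehlerDenom x y * (qExpSq q * qMehler q x y) -
      rescale q (qExpSq q * qMehler q x y) := by
  have h1 := (X_pow_dvd_qExpSq h).mul_left (rescale q (qMehler q x y))
  have h2 := (X_pow_dvd_qMehler x y h).mul_left (qExpSq q)
  convert h1.add h2 using 1
  rw [map_mul]
  ring

lemma f2_eq {q : ℂ} (x y : ℂ) (n : ℕ) :
    f2 q x y n = qPoch q n * coeff n (qExpSq q * qMehler q x y) := by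
  rw [coeff_qExpSq_mul, f2, Finset.mul_sum]
  refine Finset.sum_congr rfl fun i _ => ?_
  simp only [qMehler, coeff_mk, div_eq_mul_inv, mul_inv]
  ring

lemma d2_eq {q : ℂ} (hq : q ≠ 0) (x y : ℂ) (n : ℕ) :
    d2 q x y n = qPoch q n *
      coeff n (rescale q⁻¹ (qExpSq q⁻¹ * qMehler q⁻¹ x y)) := by
  rw [coeff_rescale, coeff_qExpSq_mul, d2, Finset.mul_sum, Finset.mul_sum, Finset.mul_sum]
  refine Finset.sum_congr rfl fun i hi => ?_
  obtain ⟨k, rfl⟩ : ∃ k, n = k + 2 * i :=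
    ⟨n - 2 * i, by have := Finset.mem_range.1 hi; omega⟩
  rw [Nat.add_sub_cancel, qPoch_eq_qPoch_inv hq i, qPoch_eq_qPoch_inv hq k,
    qInvHermite_eq_qHermite_inv hq, qInvHermite_eq_qHermite_inv hq]
  have hz : q ^ (-((k.choose 2 : ℕ) : ℤ) - (i : ℤ) + ((i.choose 2 : ℕ) : ℤ)) =
      q ^ i.choose 2 * (q ^ k.choose 2)⁻¹ * (q ^ i)⁻¹ := by
    rw [zpow_add₀ hq, zpow_sub₀ hq, zpow_neg]
    simp only [zpow_natCast]
    ring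
  rw [hz]
  have s : ∀ j : ℕ, ((-1 : ℂ) ^ j)⁻¹ = (-1) ^ j := fun j => by
    rw [← inv_pow, inv_neg, inv_one]
  have s2 : ∀ j : ℕ, ((-1 : ℂ) ^ j) * (-1) ^ j = 1 := fun j => by
    rw [← mul_pow]; simp
  have e : (-1 : ℂ) ^ (k + 2 * i) = (-1) ^ k := by simp [pow_add, pow_mul]
  simp only [qMehler, coeff_mk, div_eq_mul_inv, mul_inv, s, e, inv_pow, pow_add, pow_mul']
  have hi := s2 i
  have hk := s2 k
  generalize (-1 : ℂ) ^ i = a at *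
  generalize (-1 : ℂ) ^ k = b at *
  have hu : q ^ k.choose 2 ≠ 0 := pow_ne_zero _ hq
  have hv : q ^ i.choose 2 ≠ 0 := pow_ne_zero _ hq
  have hb4 : b ^ 4 = 1 := by linear_combination (b * b + 1) * hk
  have ha2 : a ^ 2 = 1 := by linear_combination hi
  field_simp
  rw [ha2, hb4]
  ring

/-- Finite reciprocity identity:
`∑_{j=0}^n [n choose j]_q f_j^{(2)} d_{n-j}^{(2)} = 0` for `n ≥ 1` and `q ≠ 0`. -/
theorem f2_d2_reciprocity (q x y : ℂ) (hq : q ≠ 0) (n : ℕ) (hn : 1 ≤ n) :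
    ∑ j ∈ Finset.range (n + 1),
      gaussBinom q n j * f2 q x y j * d2 q x y (n - j) = 0 := by
  set F := qExpSq q * qMehler q x y
  set F' := qExpSq q⁻¹ * qMehler q⁻¹ x y
  have hsum : ∑ j ∈ Finset.range (n + 1), gaussBinom q n j * f2 q x y j * d2 q x y (n - j) =
      qPoch q n * coeff n (F * rescale q⁻¹ F') := by
    rw [coeff_mul, Finset.Nat.sum_antidiagonal_eq_sum_range_succ_mk, Finset.mul_sum]
    refine Finset.sum_congr rfl fun j hj => ?_
    have hg := gaussBinom_add_mul_qPoch q j (n - j)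
    rw [Nat.add_sub_cancel' (Nat.lt_succ_iff.1 (Finset.mem_range.1 hj))] at hg
    rw [f2_eq, d2_eq hq, ← hg]
    ring
  rw [hsum]
  by_cases h : qPoch q n = 0
  · rw [h, zero_mul]
  have h' : qPoch q⁻¹ n ≠ 0 := right_ne_zero_of_mul (qPoch_eq_qPoch_inv hq n ▸ h)
  have hr : rescale q (rescale q⁻¹ F') = F' := by
    rw [rescale_rescale, inv_mul_cancel₀ hq, rescale_one, RingHom.id_apply]
  have hdvd : (X : ℂ⟦X⟧) ^ (n + 1) ∣ F * rescale q⁻¹ F' - rescale q (F * rescale q⁻¹ F') := by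
    have h1 := (X_pow_dvd_mehlerDenom_mul x y h).mul_left F'
    have h2 := (X_pow_dvd_mehlerDenom_mul x y h').mul_left F
    convert h1.sub h2 using 1
    rw [map_mul (rescale q) F, hr]
    ring
  have hc := X_pow_dvd_iff.1 hdvd n n.lt_succ_self
  rw [map_sub, coeff_rescale] at hc
  obtain ⟨k, rfl⟩ := Nat.exists_eq_add_of_le' hn
  have h1 : 1 - q ^ (k + 1) ≠ 0 := right_ne_zero_of_mul (qPoch_succ q k ▸ h)
  have h2 : (1 - q ^ (k + 1)) * coeff (k + 1) (F * rescale q⁻¹ F') = 0 := by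
    linear_combination hc
  rw [(mul_eq_zero.1 h2).resolve_left h1, mul_zero]
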